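/- arXiv:1708.06754 — 3 statements merged into one kernel-verified Lean document; each statement's English description precedes it below -/
import Mathlib

section
/- Let A, A⁺, A⁻ be n×n Hermitian complex matrices with A = A⁺ + A⁻, A⁺ positive semidefinite and A⁻ negative semidefinite. Let u, v ∈ ℂ^n and p ∈ ℝ. If both vᴴ A⁺ v + 2 Re(uᴴ A⁻ v) ≤ p + uᴴ A⁻ u and −vᴴ A⁻ v − 2 Re(uᴴ A⁺ v) ≤ −p − uᴴ A⁺ u hold, then vᴴ A v = p. That is, a point satisfying both convex surrogate constraints with zero slack satisfies the original nonconvex quadratic equality constraint exactly. -/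
open Matrix ComplexOrder

/-- The real quadratic form of a positive semidefinite matrix lies above its linearization. -/
theorem Matrix.PosSemidef.two_mul_re_dotProduct_mulVec_le {ι : Type*} [Fintype ι]
    {M : Matrix ι ι ℂ} (hM : M.PosSemidef) (u v : ι → ℂ) :
    2 * (star u ⬝ᵥ (M *ᵥ v)).re ≤ (star v ⬝ᵥ (M *ᵥ v)).re + (star u ⬝ᵥ (M *ᵥ u)).re := by
  have hswap : star v ⬝ᵥ (M *ᵥ u) = star (star u ⬝ᵥ (M *ᵥ v)) := by
    rw [star_dotProduct, star_mulVec, hM.isHermitian.eq, dotProduct_mulVec]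
  have hre : (star v ⬝ᵥ (M *ᵥ u)).re = (star u ⬝ᵥ (M *ᵥ v)).re := by
    rw [hswap, Complex.star_def, Complex.conj_re]
  have hnonneg := (Complex.le_def.mp (hM.dotProduct_mulVec_nonneg (v - u))).1
  simp only [star_sub, mulVec_sub, sub_dotProduct, dotProduct_sub, Complex.sub_re,
    Complex.zero_re] at hnonneg
  linarith

/-- A point satisfying both convex surrogate constraints (for the splitting `A = A⁺ + A⁻`
around a restriction point `u`) with zero slack satisfies the original nonconvex quadratic
equality `vᴴ A v = p` exactly. -/
theorem surrogate_pair_gives_equality (n : ℕ) (A Ap An : Matrix (Fin n) (Fin n) ℂ)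
    (hA : A.IsHermitian) (hAp : Ap.IsHermitian) (hAn : An.IsHermitian)
    (hsplit : A = Ap + An) (hpos : Ap.PosSemidef) (hneg : (-An).PosSemidef)
    (u v : Fin n → ℂ) (p : ℝ)
    (hsurr1 : (star v ⬝ᵥ (Ap *ᵥ v)).re + 2 * (star u ⬝ᵥ (An *ᵥ v)).re
      ≤ p + (star u ⬝ᵥ (An *ᵥ u)).re)
    (hsurr2 : -(star v ⬝ᵥ (An *ᵥ v)).re - 2 * (star u ⬝ᵥ (Ap *ᵥ v)).re
      ≤ -p - (star u ⬝ᵥ (Ap *ᵥ u)).re) :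
    (star v ⬝ᵥ (A *ᵥ v)).re = p := by
  have hp := hpos.two_mul_re_dotProduct_mulVec_le u v
  have hn := hneg.two_mul_re_dotProduct_mulVec_le u v
  simp only [neg_mulVec, dotProduct_neg, Complex.neg_re] at hn
  rw [hsplit, add_mulVec, dotProduct_add, Complex.add_re]
  linarith
end

section
/- Let A ≤ 0, B ≥ 0, C ≥ 0 be real pump coefficients, let w_max ≥ 0, and let q ≥ 0 and ĥ ≥ 0 be real numbers with ĥ ≤ A q² + (B w_max) q + (C w_max²). Then there exists w with 0 ≤ w ≤ w_max such that ĥ = A q² + B q w + C w². That is, a feasible pump speed can always be recovered from any pair (q, ĥ) satisfying the relaxed convex constraint, so replacing the pump head-gain equality by the inequality ĥ ≤ A q² + B^max q + C^max is without loss of optimality. -/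
/-- A feasible pump speed can always be recovered from any pair `(q, ĥ)` satisfying the
relaxed convex constraint: if `ĥ ≥ 0` and `ĥ ≤ A q² + (B w_max) q + (C w_max²)`, then there
exists `w ∈ [0, w_max]` with `ĥ = A q² + B q w + C w²`. -/
theorem pump_speed_recovery (A B C wmax q hhat : ℝ)
    (hA : A ≤ 0) (hB : B ≥ 0) (hC : C ≥ 0) (hwmax : wmax ≥ 0) (hq : q ≥ 0)
    (hhat0 : hhat ≥ 0)
    (hrelax : hhat ≤ A * q ^ 2 + (B * wmax) * q + (C * wmax ^ 2)) :
    ∃ w : ℝ, 0 ≤ w ∧ w ≤ wmax ∧ hhat = A * q ^ 2 + B * q * w + C * w ^ 2 := by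
  have hcont : ContinuousOn (fun w : ℝ => A * q ^ 2 + B * q * w + C * w ^ 2)
      (Set.Icc 0 wmax) := by fun_prop
  have hlower : A * q ^ 2 + B * q * 0 + C * 0 ^ 2 ≤ hhat := by
    have : A * q ^ 2 ≤ 0 := mul_nonpos_of_nonpos_of_nonneg hA (sq_nonneg q)
    linarith
  have hupper : hhat ≤ A * q ^ 2 + B * q * wmax + C * wmax ^ 2 := by
    linarith [mul_right_comm B wmax q]
  obtain ⟨w, ⟨hw0, hw1⟩, hw⟩ := intermediate_value_Icc hwmax hcont ⟨hlower, hupper⟩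
  exact ⟨w, hw0, hw1, hw.symm⟩
end

section
/- Let T, T⁺, T⁻ be real symmetric n×n matrices with T = T⁺ + T⁻, T⁺ positive semidefinite and T⁻ negative semidefinite. Let y, z ∈ ℝ^n and β ∈ ℝ. If both yᵀ T⁺ y + 2 zᵀ T⁻ y ≤ −β + zᵀ T⁻ z and −yᵀ T⁻ y − 2 zᵀ T⁺ y ≤ β − zᵀ T⁺ z hold, then yᵀ T y = −β. That is, any point satisfying both convex surrogate constraints for the water-power coupling with zero slack satisfies the original nonconvex bilinear equality exactly. -/
open Matrix

/-- A convex quadratic form lies above its linearization at any point. -/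
theorem Matrix.PosSemidef.linearization_le {ι : Type*} [Fintype ι] {A : Matrix ι ι ℝ}
    (hA : A.PosSemidef) (y z : ι → ℝ) :
    2 * (z ⬝ᵥ (A *ᵥ y)) - z ⬝ᵥ (A *ᵥ z) ≤ y ⬝ᵥ (A *ᵥ y) := by
  have hnonneg : 0 ≤ (y - z) ⬝ᵥ (A *ᵥ (y - z)) := by
    simpa using hA.dotProduct_mulVec_nonneg (y - z)
  have hcomm : y ⬝ᵥ (A *ᵥ z) = z ⬝ᵥ (A *ᵥ y) := by
    have hsymm : Aᵀ = A := by simpa using hA.isHermitian.eq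
    rw [dotProduct_mulVec, ← mulVec_transpose, hsymm, dotProduct_comm]
  simp only [mulVec_sub, sub_dotProduct, dotProduct_sub] at hnonneg
  linarith

/-- Any point satisfying both convex surrogate constraints for the water-power coupling
(with the splitting `T = T⁺ + T⁻` around a restriction point `z`, zero slack) satisfies
the original nonconvex bilinear equality `yᵀ T y = −β` exactly. -/
theorem coupling_surrogate_pair_gives_equality (n : ℕ)
    (T Tp Tn : Matrix (Fin n) (Fin n) ℝ)
    (hT : T.IsSymm) (hTp : Tp.IsSymm) (hTn : Tn.IsSymm)
    (hsplit : T = Tp + Tn) (hpos : Tp.PosSemidef) (hneg : (-Tn).PosSemidef)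
    (y z : Fin n → ℝ) (β : ℝ)
    (hsurr1 : y ⬝ᵥ (Tp *ᵥ y) + 2 * (z ⬝ᵥ (Tn *ᵥ y)) ≤ -β + z ⬝ᵥ (Tn *ᵥ z))
    (hsurr2 : -(y ⬝ᵥ (Tn *ᵥ y)) - 2 * (z ⬝ᵥ (Tp *ᵥ y)) ≤ β - z ⬝ᵥ (Tp *ᵥ z)) :
    y ⬝ᵥ (T *ᵥ y) = -β := by
  have hTp_lin := hpos.linearization_le y z
  have hTn_lin := hneg.linearization_le y z
  simp only [neg_mulVec, dotProduct_neg] at hTn_lin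
  rw [hsplit, add_mulVec, dotProduct_add]
  linarith
end
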